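/- It is decidable whether a given equation system has an E₀-unifier: under any effective (computable) encoding of equation systems as natural numbers, the set of E₀-unifiable equation systems is a computable (decidable) predicate. -/

import Mathlib

/-- Terms built from variables, free constants, two multiplication symbols
`mul` (*) and `cmul` (⊛), a binary symbol `exp`, and a unary symbol `g`. -/
inductive Tm : Type
  | var : ℕ → Tm
  | const : ℕ → Tm
  | mul : Tm → Tm → Tm
  | cmul : Tm → Tm → Tm
  | exp : Tm → Tm → Tm
  | g : Tm → Tm

/-- The equational theory E₀: the smallest congruence on terms, closed under
substitution (hence the axioms are stated for arbitrary terms), generated by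
`exp(g(X),Y) = g(X ⊛ Y)` and `exp(X*Y,Z) = exp(X,Z) * exp(Y,Z)`. -/
inductive E0 : Tm → Tm → Prop
  | ax1 (x y : Tm) : E0 (.exp (.g x) y) (.g (.cmul x y))
  | ax2 (x y z : Tm) : E0 (.exp (.mul x y) z) (.mul (.exp x z) (.exp y z))
  | refl (t : Tm) : E0 t t
  | symm {s t : Tm} : E0 s t → E0 t s
  | trans {s t u : Tm} : E0 s t → E0 t u → E0 s u
  | mul_congr {a b c d : Tm} : E0 a b → E0 c d → E0 (.mul a c) (.mul b d)
  | cmul_congr {a b c d : Tm} : E0 a b → E0 c d → E0 (.cmul a c) (.cmul b d)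
  | exp_congr {a b c d : Tm} : E0 a b → E0 c d → E0 (.exp a c) (.exp b d)
  | g_congr {a b : Tm} : E0 a b → E0 (.g a) (.g b)

/-- A ground term contains no variables. -/
def Tm.Ground : Tm → Prop
  | .var _ => False
  | .const _ => True
  | .mul s t => s.Ground ∧ t.Ground
  | .cmul s t => s.Ground ∧ t.Ground
  | .exp s t => s.Ground ∧ t.Ground
  | .g t => t.Ground


/-- Flat right-hand sides of equations: a variable, or `g(V)`, `exp(V,W)`,
`V*W`, `V⊛W` with `V`, `W` variables. -/
inductive Flat : Type
  | var : ℕ → Flat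
  | g : ℕ → Flat
  | exp : ℕ → ℕ → Flat
  | mul : ℕ → ℕ → Flat
  | cmul : ℕ → ℕ → Flat
deriving DecidableEq

/-- An equation `U =? t` is a pair of a variable and a flat term. -/
abbrev Eqn : Type := ℕ × Flat

/-- An equation system is a finite set of equations. -/
abbrev Sys : Type := Finset Eqn

/-- Interpretation of a flat term under a substitution. -/
def Flat.toTm (σ : ℕ → Tm) : Flat → Tm
  | .var v => σ v
  | .g v => .g (σ v)
  | .exp v w => .exp (σ v) (σ w)
  | .mul v w => .mul (σ v) (σ w)
  | .cmul v w => .cmul (σ v) (σ w)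

/-- `σ` is an E₀-unifier of `S` iff `σ(U) =_{E₀} σ(t)` for each `U =? t` in `S`. -/
def IsUnifier (σ : ℕ → Tm) (S : Sys) : Prop :=
  ∀ e ∈ S, E0 (σ e.1) (Flat.toTm σ e.2)

/-- The variables occurring in a flat term. -/
def Flat.vars : Flat → Finset ℕ
  | .var v => {v}
  | .g v => {v}
  | .exp v w => {v, w}
  | .mul v w => {v, w}
  | .cmul v w => {v, w}

/-- A flat term is a non-variable term. -/
def Flat.NonVar : Flat → Prop
  | .var _ => False
  | _ => True

/-- `U ≻ V` iff `S` contains an equation `U =? t` with `t` a non-variable term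
containing `V`. -/
def Succ (S : Sys) (U V : ℕ) : Prop :=
  ∃ t : Flat, (U, t) ∈ S ∧ t.NonVar ∧ V ∈ t.vars

/-- `U ≻_b V` iff `S` contains an equation `U =? exp(V,W)`. -/
def SuccB (S : Sys) (U V : ℕ) : Prop :=
  ∃ W, (U, Flat.exp V W) ∈ S

/-- `U ≻_m V` iff `S` contains an equation `U =? V*W` or `U =? W*V`. -/
def SuccM (S : Sys) (U V : ℕ) : Prop :=
  ∃ W, (U, Flat.mul V W) ∈ S ∨ (U, Flat.mul W V) ∈ S

/-- `∼` is the reflexive-symmetric-transitive closure of `≻_b`. -/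
def Sim (S : Sys) : ℕ → ℕ → Prop :=
  Relation.EqvGen (SuccB S)

/-- An explicit equivalence of `Flat` with a `Primcodable` type, providing an
effective encoding of flat terms (and hence, via lists, of equation systems)
as natural numbers. -/
def flatEquiv : Flat ≃ (ℕ ⊕ ℕ ⊕ (ℕ × ℕ) ⊕ (ℕ × ℕ) ⊕ (ℕ × ℕ)) where
  toFun
    | .var v => .inl v
    | .g v => .inr (.inl v)
    | .exp v w => .inr (.inr (.inl (v, w)))
    | .mul v w => .inr (.inr (.inr (.inl (v, w))))
    | .cmul v w => .inr (.inr (.inr (.inr (v, w))))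
  invFun
    | .inl v => .var v
    | .inr (.inl v) => .g v
    | .inr (.inr (.inl (v, w))) => .exp v w
    | .inr (.inr (.inr (.inl (v, w)))) => .mul v w
    | .inr (.inr (.inr (.inr (v, w)))) => .cmul v w
  left_inv := by rintro (_ | _ | _ | _ | _) <;> rfl
  right_inv := by rintro (_ | _ | ⟨_, _⟩ | ⟨_, _⟩ | ⟨_, _⟩) <;> rfl

instance : Primcodable Flat := Primcodable.ofEquiv _ flatEquiv

/-! ### Encoding equations as quadruples -/

/-- A quadruple `(k, u, v, w)` stands for an equation between `u` and the operation with tag `k`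
applied to `v` and `w`. -/
abbrev Quad : Type := ℕ × ℕ × ℕ × ℕ

/-- The operation on terms with a given tag: `0` is the first projection, `1` is `g` of the first
argument, and `2`, `3` and all larger tags are `exp`, `*` and `⊛`. -/
def tagOp : ℕ → Tm → Tm → Tm
  | 0, s, _ => s
  | 1, s, _ => .g s
  | 2, s, t => .exp s t
  | 3, s, t => .mul s t
  | _, s, t => .cmul s t

/-- The quadruple of an equation. -/
def Flat.toQuad (u : ℕ) : Flat → Quad
  | .var v => (0, u, v, v)
  | .g v => (1, u, v, v)
  | .exp v w => (2, u, v, w)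
  | .mul v w => (3, u, v, w)
  | .cmul v w => (4, u, v, w)

theorem tagOp_toQuad (σ : ℕ → Tm) (u : ℕ) (t : Flat) :
    tagOp (t.toQuad u).1 (σ (t.toQuad u).2.2.1) (σ (t.toQuad u).2.2.2) = t.toTm σ := by
  cases t <;> rfl

theorem toQuad_snd_fst (u : ℕ) (t : Flat) : (t.toQuad u).2.1 = u := by
  cases t <;> rfl

theorem toQuad_tag_le (u : ℕ) (t : Flat) : (t.toQuad u).1 ≤ 4 := by
  cases t <;> simp [Flat.toQuad]

theorem toQuad_of_tag_le_one (u : ℕ) (t : Flat) (h : (t.toQuad u).1 ≤ 1) :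
    (t.toQuad u).2.2.2 = (t.toQuad u).2.2.1 := by
  cases t <;> simp_all [Flat.toQuad]

theorem primrec_toQuad : Primrec fun e : Eqn => e.2.toQuad e.1 := by
  have hE : Primrec flatEquiv := Primrec.of_equiv
  have h : Primrec fun e : Eqn =>
      (Sum.casesOn (flatEquiv e.2) (fun v => (0, e.1, v, v)) fun s =>
        Sum.casesOn s (fun v => (1, e.1, v, v)) fun s =>
        Sum.casesOn s (fun p => (2, e.1, p.1, p.2)) fun s =>
        Sum.casesOn s (fun p => (3, e.1, p.1, p.2)) fun p => (4, e.1, p.1, p.2) : Quad) := by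
    refine Primrec.sumCasesOn (hE.comp .snd) ?_ ?_
    · exact (Primrec.const _).pair ((Primrec.fst.comp .fst).pair (Primrec.snd.pair .snd))
    refine Primrec.sumCasesOn .snd ?_ ?_
    · exact (Primrec.const _).pair
        ((Primrec.fst.comp <| Primrec.fst.comp .fst).pair (Primrec.snd.pair .snd))
    refine Primrec.sumCasesOn .snd ?_ ?_
    · exact (Primrec.const _).pair
        ((Primrec.fst.comp <| Primrec.fst.comp <| Primrec.fst.comp .fst).pair .snd)
    refine Primrec.sumCasesOn .snd ?_ ?_
    · exact (Primrec.const _).pair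
        ((Primrec.fst.comp <| Primrec.fst.comp <| Primrec.fst.comp <| Primrec.fst.comp .fst).pair
          .snd)
    · exact (Primrec.const _).pair
        ((Primrec.fst.comp <| Primrec.fst.comp <| Primrec.fst.comp <| Primrec.fst.comp .fst).pair
          .snd)
  refine h.of_eq ?_
  rintro ⟨u, _ | _ | _ | _ | _⟩ <;> rfl

/-! ### Certificates -/

/-- Every equation of `K` holds in `Q`, where the quadruples of `Q` with tag `0` assign nodes to
the variables of `K`, and the other ones describe the operations on nodes. -/
def Realizes (K Q : List Quad) : Prop :=
  ∀ e ∈ K, ∃ x ∈ Q, ∃ y ∈ Q, ∃ z ∈ Q,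
    (x.1 = 0 ∧ x.2.1 = e.2.1) ∧ (y.1 = 0 ∧ y.2.1 = e.2.2.1) ∧ (z.1 = 0 ∧ z.2.1 = e.2.2.2) ∧
    ((e.1 = 0 ∧ x.2.2.1 = y.2.2.1) ∨ (¬ e.1 = 0 ∧ (e.1, x.2.2.1, y.2.2.1, z.2.2.1) ∈ Q))

/-- The two equations `x : u = g(a)` and `y : u = exp(b, c)` have been decomposed in `Q`. -/
def SplitG (Q : List Quad) (x y : Quad) : Prop :=
  ∃ z ∈ Q, z.1 = 1 ∧ z.2.1 = y.2.2.1 ∧ (4, x.2.2.1, z.2.2.1, y.2.2.2) ∈ Q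

/-- The two equations `x : u = exp(b, c)` and `y : u = a * a'` have been decomposed in `Q`. -/
def SplitMul (Q : List Quad) (x y : Quad) : Prop :=
  ∃ z ∈ Q, z.1 = 3 ∧ z.2.1 = x.2.2.1 ∧ (2, y.2.2.1, z.2.2.1, x.2.2.2) ∈ Q ∧
    (2, y.2.2.2, z.2.2.2, x.2.2.2) ∈ Q

/-- `Q` is acyclic, functional, and closed under decomposition. -/
def Coherent (Q : List Quad) : Prop :=
  ∀ x ∈ Q, (x.1 = 0 ∨ (x.2.2.1 < x.2.1 ∧ x.2.2.2 < x.2.1)) ∧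
    ∀ y ∈ Q, ¬ x.2.1 = y.2.1 ∨ x.1 = 0 ∨ (¬ x.1 < y.1 ∧ (¬ x.1 = y.1 ∨ x = y)) ∨
      (x.1 = 1 ∧ y.1 = 2 ∧ SplitG Q x y) ∨ (x.1 = 2 ∧ y.1 = 3 ∧ SplitMul Q x y)

/-- The assignment of nodes to variables in `Q` is functional. -/
def Functional (Q : List Quad) : Prop :=
  ∀ x ∈ Q, ∀ y ∈ Q, ¬ x.1 = 0 ∨ ¬ y.1 = 0 ∨ ¬ x.2.1 = y.2.1 ∨ x.2.2.1 = y.2.2.1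

/-- `Q` certifies that the system `K` is unifiable. -/
def Certifies (Q K : List Quad) : Prop :=
  Realizes K Q ∧ Coherent Q ∧ Functional Q

section Computability

theorem PrimrecPred.exists_mem {α β : Type*} [Primcodable α] [Primcodable β] {f : α → List β}
    {p : α → β → Prop} (hf : Primrec f) (hp : PrimrecPred fun x : α × β => p x.1 x.2) :
    PrimrecPred fun a => ∃ b ∈ f a, p a b :=
  (PrimrecRel.swap hp).exists_mem_list.comp hf .id

theorem PrimrecPred.forall_mem {α β : Type*} [Primcodable α] [Primcodable β] {f : α → List β}
    {p : α → β → Prop} (hf : Primrec f) (hp : PrimrecPred fun x : α × β => p x.1 x.2) :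
    PrimrecPred fun a => ∀ b ∈ f a, p a b :=
  (PrimrecRel.swap hp).forall_mem_list.comp hf .id

theorem PrimrecPred.mem_list {α β : Type*} [Primcodable α] [Primcodable β] {f : α → List β}
    {g : α → β} (hf : Primrec f) (hg : Primrec g) : PrimrecPred fun a => g a ∈ f a :=
  (PrimrecPred.exists_mem (p := fun a b => b = g a) hf
    (Primrec.eq.comp .snd (hg.comp .fst))).of_eq fun a => by simp

theorem PrimrecPred.eq_comp {α β : Type*} [Primcodable α] [Primcodable β] {f g : α → β}
    (hf : Primrec f) (hg : Primrec g) : PrimrecPred fun a => f a = g a :=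
  Primrec.eq.comp hf hg

theorem PrimrecPred.lt_comp {α : Type*} [Primcodable α] {f g : α → ℕ}
    (hf : Primrec f) (hg : Primrec g) : PrimrecPred fun a => f a < g a :=
  Primrec.nat_lt.comp hf hg

section Fields

variable {α : Type*} [Primcodable α] {f : α → Quad}

theorem primrec_quad_fst (hf : Primrec f) : Primrec fun a => (f a).1 := Primrec.fst.comp hf

theorem primrec_quad_snd (hf : Primrec f) : Primrec fun a => (f a).2.1 :=
  Primrec.fst.comp (Primrec.snd.comp hf)

theorem primrec_quad_thd (hf : Primrec f) : Primrec fun a => (f a).2.2.1 :=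
  Primrec.fst.comp (Primrec.snd.comp (Primrec.snd.comp hf))

theorem primrec_quad_fth (hf : Primrec f) : Primrec fun a => (f a).2.2.2 :=
  Primrec.snd.comp (Primrec.snd.comp (Primrec.snd.comp hf))

end Fields

theorem primrecPred_realizes : PrimrecPred fun p : List Quad × List Quad => Realizes p.1 p.2 := by
  have hQ : Primrec fun p : (((((List Quad × List Quad) × Quad) × Quad) × Quad) × Quad) =>
      p.1.1.1.1.2 :=
    Primrec.snd.comp (Primrec.fst.comp (Primrec.fst.comp (Primrec.fst.comp .fst)))
  have he : Primrec fun p : (((((List Quad × List Quad) × Quad) × Quad) × Quad) × Quad) =>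
      p.1.1.1.2 := Primrec.snd.comp (Primrec.fst.comp (Primrec.fst.comp .fst))
  have hx : Primrec fun p : (((((List Quad × List Quad) × Quad) × Quad) × Quad) × Quad) =>
      p.1.1.2 := Primrec.snd.comp (Primrec.fst.comp .fst)
  have hy : Primrec fun p : (((((List Quad × List Quad) × Quad) × Quad) × Quad) × Quad) =>
      p.1.2 := Primrec.snd.comp .fst
  have hz : Primrec fun p : (((((List Quad × List Quad) × Quad) × Quad) × Quad) × Quad) =>
      p.2 := Primrec.snd
  have h0 {α : Type} [Primcodable α] : Primrec fun _ : α => 0 := Primrec.const 0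
  refine .forall_mem .fst <| .exists_mem (Primrec.snd.comp .fst) <|
    .exists_mem (Primrec.snd.comp <| Primrec.fst.comp .fst) <|
    .exists_mem (Primrec.snd.comp <| Primrec.fst.comp <| Primrec.fst.comp .fst) ?_
  exact .and (.and (.eq_comp (primrec_quad_fst hx) h0)
      (.eq_comp (primrec_quad_snd hx) (primrec_quad_snd he))) <|
    .and (.and (.eq_comp (primrec_quad_fst hy) h0)
      (.eq_comp (primrec_quad_snd hy) (primrec_quad_thd he))) <|
    .and (.and (.eq_comp (primrec_quad_fst hz) h0)
      (.eq_comp (primrec_quad_snd hz) (primrec_quad_fth he))) <|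
    .or (.and (.eq_comp (primrec_quad_fst he) h0)
      (.eq_comp (primrec_quad_thd hx) (primrec_quad_thd hy)))
      (.and (.not (.eq_comp (primrec_quad_fst he) h0))
        (.mem_list hQ ((primrec_quad_fst he).pair ((primrec_quad_thd hx).pair
          ((primrec_quad_thd hy).pair (primrec_quad_thd hz))))))

theorem primrecPred_splitG :
    PrimrecPred fun p : (List Quad × Quad) × Quad => SplitG p.1.1 p.1.2 p.2 := by
  have hQ : Primrec fun p : ((List Quad × Quad) × Quad) × Quad => p.1.1.1 :=
    Primrec.fst.comp (Primrec.fst.comp .fst)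
  have hx : Primrec fun p : ((List Quad × Quad) × Quad) × Quad => p.1.1.2 :=
    Primrec.snd.comp (Primrec.fst.comp .fst)
  have hy : Primrec fun p : ((List Quad × Quad) × Quad) × Quad => p.1.2 :=
    Primrec.snd.comp .fst
  refine .exists_mem (Primrec.fst.comp .fst) ?_
  exact .and (.eq_comp (primrec_quad_fst .snd) (.const _)) <|
    .and (.eq_comp (primrec_quad_snd .snd) (primrec_quad_thd hy)) <|
    .mem_list hQ ((Primrec.const _).pair ((primrec_quad_thd hx).pair
      ((primrec_quad_thd .snd).pair (primrec_quad_fth hy))))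

theorem primrecPred_splitMul :
    PrimrecPred fun p : (List Quad × Quad) × Quad => SplitMul p.1.1 p.1.2 p.2 := by
  have hQ : Primrec fun p : ((List Quad × Quad) × Quad) × Quad => p.1.1.1 :=
    Primrec.fst.comp (Primrec.fst.comp .fst)
  have hx : Primrec fun p : ((List Quad × Quad) × Quad) × Quad => p.1.1.2 :=
    Primrec.snd.comp (Primrec.fst.comp .fst)
  have hy : Primrec fun p : ((List Quad × Quad) × Quad) × Quad => p.1.2 :=
    Primrec.snd.comp .fst
  refine .exists_mem (Primrec.fst.comp .fst) ?_
  exact .and (.eq_comp (primrec_quad_fst .snd) (.const _)) <|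
    .and (.eq_comp (primrec_quad_snd .snd) (primrec_quad_thd hx)) <|
    .and (.mem_list hQ ((Primrec.const _).pair ((primrec_quad_thd hy).pair
      ((primrec_quad_thd .snd).pair (primrec_quad_fth hx)))))
    (.mem_list hQ ((Primrec.const _).pair ((primrec_quad_fth hy).pair
      ((primrec_quad_fth .snd).pair (primrec_quad_fth hx)))))

theorem primrecPred_coherent : PrimrecPred Coherent := by
  have hx : Primrec fun p : (List Quad × Quad) × Quad => p.1.2 := Primrec.snd.comp .fst
  refine .forall_mem .id <| .and (.or (.eq_comp (primrec_quad_fst .snd) (.const _))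
    (.and (.lt_comp (primrec_quad_thd .snd) (primrec_quad_snd .snd))
      (.lt_comp (primrec_quad_fth .snd) (primrec_quad_snd .snd)))) (.forall_mem .fst ?_)
  exact .or (.not (.eq_comp (primrec_quad_snd hx) (primrec_quad_snd .snd))) <|
    .or (.eq_comp (primrec_quad_fst hx) (.const _)) <|
    .or (.and (.not (.lt_comp (primrec_quad_fst hx) (primrec_quad_fst .snd)))
      (.or (.not (.eq_comp (primrec_quad_fst hx) (primrec_quad_fst .snd)))
        (.eq_comp hx .snd))) <|
    .or (.and (.eq_comp (primrec_quad_fst hx) (.const _))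
      (.and (.eq_comp (primrec_quad_fst .snd) (.const _)) primrecPred_splitG))
      (.and (.eq_comp (primrec_quad_fst hx) (.const _))
        (.and (.eq_comp (primrec_quad_fst .snd) (.const _)) primrecPred_splitMul))

theorem primrecPred_functional : PrimrecPred Functional := by
  have hx : Primrec fun p : (List Quad × Quad) × Quad => p.1.2 := Primrec.snd.comp .fst
  refine .forall_mem .id <| .forall_mem .fst ?_
  exact .or (.not (.eq_comp (primrec_quad_fst hx) (.const _))) <|
    .or (.not (.eq_comp (primrec_quad_fst .snd) (.const _))) <|
    .or (.not (.eq_comp (primrec_quad_snd hx) (primrec_quad_snd .snd)))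
      (.eq_comp (primrec_quad_thd hx) (primrec_quad_thd .snd))

theorem primrecPred_certifies :
    PrimrecPred fun p : List Quad × List Quad => Certifies p.2 p.1 :=
  .and primrecPred_realizes <|
    .and (primrecPred_coherent.comp .snd) (primrecPred_functional.comp .snd)

/-- A number exceeding all entries of the quadruples in a list. -/
def entryBound (K : List Quad) : ℕ :=
  K.foldr (fun e n => (e.2.1 + (e.2.2.1 + e.2.2.2) + 1) + n) 0

theorem lt_entryBound {K : List Quad} {e : Quad} (h : e ∈ K) :
    e.2.1 < entryBound K ∧ e.2.2.1 < entryBound K ∧ e.2.2.2 < entryBound K := by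
  induction K with
  | nil => simp at h
  | cons a K ih =>
    simp only [entryBound, List.foldr_cons, List.mem_cons] at h ih ⊢
    rcases h with rfl | h
    · omega
    · have := ih h
      omega

theorem primrec_entryBound : Primrec entryBound := by
  have h : Primrec₂ fun (_ : List Quad) (p : Quad × ℕ) =>
      (p.1.2.1 + (p.1.2.2.1 + p.1.2.2.2) + 1) + p.2 := Primrec.nat_add.comp
    (Primrec.nat_add.comp (Primrec.nat_add.comp (primrec_quad_snd (Primrec.fst.comp .snd))
      (Primrec.nat_add.comp (primrec_quad_thd (Primrec.fst.comp .snd))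
        (primrec_quad_fth (Primrec.fst.comp .snd)))) (.const 1))
    (Primrec.snd.comp .snd)
  exact Primrec.list_foldr .id (.const 0) h

/-- A bound for the entries of a certificate of a system whose variables are less than `m`. -/
def certBound (m : ℕ) : ℕ := 2 * (3 ^ m * m) + m + 5

theorem primrec_certBound : Primrec certBound := by
  have hpow : Primrec fun m : ℕ => 3 ^ m :=
    (Primrec.nat_rec₁ 1 (Primrec.nat_mul.comp Primrec.snd (.const 3)).to₂).of_eq fun m => by
      induction m with
      | zero => rfl
      | succ m ih => rw [pow_succ, ← ih]
  exact Primrec.nat_add.comp (Primrec.nat_add.comp (Primrec.nat_mul.comp (.const 2)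
    (Primrec.nat_mul.comp hpow .id)) .id) (.const 5)

/-- A list containing all quadruples with entries less than `n`. -/
def quads (n : ℕ) : List Quad :=
  (List.range (n * n * (n * n) * (n * n * (n * n)))).map fun c =>
    (c.unpair.1, c.unpair.2.unpair.1, c.unpair.2.unpair.2.unpair.1, c.unpair.2.unpair.2.unpair.2)

theorem Nat.pair_lt_mul_self {a b n : ℕ} (ha : a < n) (hb : b < n) : Nat.pair a b < n * n := by
  refine (Nat.pair_lt_max_add_one_sq a b).trans_le ?_
  rw [sq]
  have : max a b + 1 ≤ n := by omega
  exact Nat.mul_le_mul this this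

theorem mem_quads {n k u v w : ℕ} (hk : k < n) (hu : u < n) (hv : v < n) (hw : w < n) :
    (k, u, v, w) ∈ quads n := by
  have hn : n ≤ n * n := Nat.le_mul_self n
  have hn' : n * n ≤ n * n * (n * n) := Nat.le_mul_self _
  refine List.mem_map.2 ⟨Nat.pair k (Nat.pair u (Nat.pair v w)), ?_, by simp⟩
  have h1 : Nat.pair v w < n * n := Nat.pair_lt_mul_self hv hw
  have h2 := Nat.pair_lt_mul_self (hu.trans_le hn) h1
  exact List.mem_range.2 (Nat.pair_lt_mul_self (hk.trans_le (hn.trans hn')) h2)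

theorem primrec_quads : Primrec quads := by
  have hsq : Primrec fun n : ℕ => n * n := Primrec.nat_mul.comp .id .id
  refine Primrec.list_map (Primrec.list_range.comp (hsq.comp (hsq.comp hsq))) ?_
  have h1 : Primrec fun p : ℕ × ℕ => p.2.unpair := Primrec.unpair.comp .snd
  have h2 : Primrec fun p : ℕ × ℕ => p.2.unpair.2.unpair :=
    Primrec.unpair.comp (Primrec.snd.comp h1)
  have h3 : Primrec fun p : ℕ × ℕ => p.2.unpair.2.unpair.2.unpair :=
    Primrec.unpair.comp (Primrec.snd.comp h2)
  exact (Primrec.fst.comp h1).pair ((Primrec.fst.comp h2).pair h3)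

/-- The list of all sublists of a list. -/
def allSublists {α : Type*} (l : List α) : List (List α) :=
  l.foldr (fun a S => S ++ S.map (List.cons a)) [[]]

theorem filter_mem_allSublists {α : Type*} (p : α → Bool) (l : List α) :
    l.filter p ∈ allSublists l := by
  induction l with
  | nil => simp [allSublists]
  | cons a l ih =>
    simp only [allSublists, List.foldr_cons, List.mem_append, List.mem_map] at ih ⊢
    by_cases h : p a = true
    · exact Or.inr ⟨_, ih, by simp [h]⟩
    · exact Or.inl (by simpa [h] using ih)

theorem primrec_allSublists {α : Type*} [Primcodable α] :
    Primrec (allSublists : List α → List (List α)) := by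
  have hcons : Primrec₂ fun (p : List α × α × List (List α)) (l : List α) => p.2.1 :: l :=
    Primrec.list_cons.comp (Primrec.fst.comp <| Primrec.snd.comp .fst) .snd
  have h : Primrec₂ fun (_ : List α) (p : α × List (List α)) =>
      p.2 ++ p.2.map (List.cons p.1) :=
    Primrec.list_append.comp (Primrec.snd.comp .snd)
      (Primrec.list_map (Primrec.snd.comp .snd) hcons)
  exact Primrec.list_foldr .id (.const [[]]) h

theorem computablePred_exists_certificate :
    ComputablePred fun L : List Eqn => ∃ Q ∈ allSublists
      (quads (certBound (entryBound (L.map fun e => e.2.toQuad e.1)))),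
        Certifies Q (L.map fun e => e.2.toQuad e.1) := by
  have hK : Primrec fun L : List Eqn => L.map fun e => e.2.toQuad e.1 :=
    Primrec.list_map .id (primrec_toQuad.comp .snd)
  obtain ⟨i, h⟩ := PrimrecPred.exists_mem (p := fun (L : List Eqn) Q =>
      Certifies Q (L.map fun e => e.2.toQuad e.1))
    (primrec_allSublists.comp <| primrec_quads.comp <| primrec_certBound.comp <|
      primrec_entryBound.comp hK)
    (primrecPred_certifies.comp ((hK.comp .fst).pair .snd))
  exact ⟨i, h.to_comp⟩

end Computability

/-! ### A certified system is unifiable -/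

theorem E0.tagOp_congr {a b c d : Tm} (k : ℕ) (h : E0 a b) (hcd : E0 c d) :
    E0 (tagOp k a c) (tagOp k b d) := by
  match k with
  | 0 => exact h
  | 1 => exact h.g_congr
  | 2 => exact h.exp_congr hcd
  | 3 => exact h.mul_congr hcd
  | _ + 4 => exact h.cmul_congr hcd

/-- The equation given by a quadruple holds for an assignment of terms to nodes. -/
def Quad.Holds (τ : ℕ → Tm) (x : Quad) : Prop :=
  E0 (τ x.2.1) (tagOp x.1 (τ x.2.2.1) (τ x.2.2.2))

theorem SplitG.e0 {Q : List Quad} {x y : Quad} {τ : ℕ → Tm} (h : SplitG Q x y)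
    (hx : x.1 = 1) (hy : y.1 = 2)
    (hτ : ∀ z ∈ Q, ¬ z.1 = 0 → z.2.1 = x.2.2.1 ∨ z.2.1 = y.2.2.1 → z.Holds τ) :
    E0 (tagOp y.1 (τ y.2.2.1) (τ y.2.2.2)) (tagOp x.1 (τ x.2.2.1) (τ x.2.2.2)) := by
  obtain ⟨z, hz, hz1, hz2, hz3⟩ := h
  have h1 := hτ z hz (by omega) (.inr hz2)
  have h2 := hτ _ hz3 (by simp) (.inl rfl)
  simp only [Quad.Holds, hz1, hz2, tagOp] at h1 h2
  simp only [hx, hy, tagOp]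
  exact (h1.exp_congr (.refl _)).trans <| (E0.ax1 _ _).trans h2.symm.g_congr

theorem SplitMul.e0 {Q : List Quad} {x y : Quad} {τ : ℕ → Tm} (h : SplitMul Q x y)
    (hx : x.1 = 2) (hy : y.1 = 3)
    (hτ : ∀ z ∈ Q, ¬ z.1 = 0 →
      z.2.1 = x.2.2.1 ∨ z.2.1 = y.2.2.1 ∨ z.2.1 = y.2.2.2 → z.Holds τ) :
    E0 (tagOp y.1 (τ y.2.2.1) (τ y.2.2.2)) (tagOp x.1 (τ x.2.2.1) (τ x.2.2.2)) := by
  obtain ⟨z, hz, hz1, hz2, hz3, hz4⟩ := h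
  have h1 := hτ z hz (by omega) (.inl hz2)
  have h2 := hτ _ hz3 (by simp) (.inr (.inl rfl))
  have h3 := hτ _ hz4 (by simp) (.inr (.inr rfl))
  simp only [Quad.Holds, hz1, hz2, tagOp] at h1 h2 h3
  simp only [hx, hy, tagOp]
  exact (h2.mul_congr h3).trans <| (E0.ax2 _ _ _).symm.trans (h1.symm.exp_congr (.refl _))

theorem Coherent.exists_holds {Q : List Quad} (hQ : Coherent Q) (n : ℕ) :
    ∃ τ : ℕ → Tm, ∀ x ∈ Q, ¬ x.1 = 0 → x.2.1 < n → x.Holds τ := by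
  induction n with
  | zero => exact ⟨Tm.var, by simp⟩
  | succ n ih =>
    obtain ⟨τ, hτ⟩ := ih
    have hlt : ∀ x ∈ Q, ¬ x.1 = 0 → x.2.2.1 < x.2.1 ∧ x.2.2.2 < x.2.1 := fun x hx h0 =>
      (hQ x hx).1.resolve_left h0
    obtain ⟨t, ht⟩ : ∃ t : Tm, ∀ x ∈ Q, ¬ x.1 = 0 → x.2.1 = n →
        E0 t (tagOp x.1 (τ x.2.2.1) (τ x.2.2.2)) := by
      by_cases hne : (Q.toFinset.filter fun x => ¬ x.1 = 0 ∧ x.2.1 = n).Nonempty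
      · obtain ⟨y, hy, hmax⟩ := Finset.exists_max_image _ (fun x : Quad => x.1) hne
        simp only [Finset.mem_filter, List.mem_toFinset] at hy hmax
        refine ⟨tagOp y.1 (τ y.2.2.1) (τ y.2.2.2), fun x hx h0 hxn => ?_⟩
        have hle := hmax x ⟨hx, h0, hxn⟩
        have hxlt := hlt x hx h0
        have hylt := hlt y hy.1 hy.2.1
        rcases (hQ x hx).2 y hy.1 with h | h | h | ⟨hx1, hy1, h⟩ | ⟨hx1, hy1, h⟩
        · omega
        · exact absurd h h0
        · rw [h.2.resolve_left (by omega)]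
          exact .refl _
        · exact h.e0 hx1 hy1 fun z hz hz0 hzn => hτ z hz hz0 (by omega)
        · exact h.e0 hx1 hy1 fun z hz hz0 hzn => hτ z hz hz0 (by omega)
      · refine ⟨.var 0, fun x hx h0 hxn => (hne ⟨x, ?_⟩).elim⟩
        simp [hx, h0, hxn]
    refine ⟨Function.update τ n t, fun x hx h0 hxn => ?_⟩
    have hxlt := hlt x hx h0
    rw [Quad.Holds, Function.update_of_ne (a := x.2.2.1) (by omega),
      Function.update_of_ne (a := x.2.2.2) (by omega)]
    by_cases h : x.2.1 = n
    · rw [h, Function.update_self]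
      exact ht x hx h0 h
    · rw [Function.update_of_ne h]
      exact hτ x hx h0 (by omega)

theorem Certifies.exists_holds {Q K : List Quad} (h : Certifies Q K) :
    ∃ σ : ℕ → Tm, ∀ e ∈ K, e.Holds σ := by
  obtain ⟨hR, hC, hF⟩ := h
  obtain ⟨τ, hτ⟩ := hC.exists_holds (entryBound Q)
  classical
  let ρ : ℕ → ℕ := fun u => if h : ∃ x ∈ Q, x.1 = 0 ∧ x.2.1 = u then h.choose.2.2.1 else 0
  have hρ : ∀ x ∈ Q, x.1 = 0 → ρ x.2.1 = x.2.2.1 := by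
    intro x hx h0
    have hex : ∃ y ∈ Q, y.1 = 0 ∧ y.2.1 = x.2.1 := ⟨x, hx, h0, rfl⟩
    simp only [ρ, dif_pos hex]
    have hy := hex.choose_spec
    have := hF _ hy.1 x hx
    tauto
  refine ⟨fun u => τ (ρ u), fun e he => ?_⟩
  obtain ⟨x, hx, y, hy, z, hz, ⟨hx0, hxe⟩, ⟨hy0, hye⟩, ⟨hz0, hze⟩, h⟩ := hR e he
  have h1 := hρ x hx hx0
  have h2 := hρ y hy hy0
  have h3 := hρ z hz hz0
  rw [hxe] at h1
  rw [hye] at h2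
  rw [hze] at h3
  simp only [Quad.Holds, h1, h2, h3]
  rcases h with ⟨h0, h⟩ | ⟨h0, h⟩
  · rw [h0, h]
    exact .refl _
  · exact hτ _ h h0 (lt_entryBound h).1

/-! ### The algebra of normal forms -/

namespace Tm

/-- Exponentiation of normal forms. -/
def pow : Tm → Tm → Tm
  | .g x, y => .g (.cmul x y)
  | .mul a b, y => .mul (a.pow y) (b.pow y)
  | .var n, y => .exp (.var n) y
  | .const n, y => .exp (.const n) y
  | .cmul a b, y => .exp (.cmul a b) y
  | .exp a b, y => .exp (.exp a b) y

/-- The normal form of a term. -/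
def nf : Tm → Tm
  | .var n => .var n
  | .const n => .const n
  | .mul a b => .mul a.nf b.nf
  | .cmul a b => .cmul a.nf b.nf
  | .exp a b => a.nf.pow b.nf
  | .g a => .g a.nf

/-- The number of symbols of a term. -/
def size : Tm → ℕ
  | .var _ => 1
  | .const _ => 1
  | .mul a b => a.size + b.size + 1
  | .cmul a b => a.size + b.size + 1
  | .exp a b => a.size + b.size + 1
  | .g a => a.size + 1

/-- The term obtained by collapsing all maximal subterms that are not products. -/
def shape : Tm → Tm
  | .mul a b => .mul a.shape b.shape
  | _ => .const 0

/-- The factors of a product. -/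
def factors : Tm → List Tm
  | .mul a b => [a, b]
  | _ => []

/-- The argument of `g`. -/
def gArg : Tm → List Tm
  | .g a => [a]
  | _ => []

theorem pow_eq_g {a b x : Tm} (h : a.pow b = .g x) : ∃ y, a = .g y ∧ x = .cmul y b := by
  cases a <;> simp_all [pow]

theorem pow_eq_mul {a b x y : Tm} (h : a.pow b = .mul x y) :
    ∃ c d, a = .mul c d ∧ x = c.pow b ∧ y = d.pow b := by
  cases a <;> simp_all [pow]

theorem pow_ne_cmul (a b x y : Tm) : a.pow b ≠ .cmul x y := by
  cases a <;> simp [pow]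

theorem pow_inj {a b c d : Tm} (h : a.pow b = c.pow d) : a = c ∧ b = d := by
  induction a generalizing c with
  | mul a₁ a₂ ih₁ ih₂ =>
    obtain ⟨c₁, c₂, rfl, h₁, h₂⟩ := pow_eq_mul h.symm
    exact ⟨congrArg₂ _ (ih₁ h₁).1 (ih₂ h₂).1, (ih₁ h₁).2⟩
  | _ => cases c <;> simp_all [pow]

theorem size_lt_pow (a b : Tm) : a.size < (a.pow b).size ∧ b.size < (a.pow b).size := by
  induction a <;> simp only [pow, size] <;> omega

theorem shape_pow (a b : Tm) : (a.pow b).shape = a.shape := by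
  induction a <;> simp_all [pow, shape]

end Tm

theorem E0.nf_eq {s t : Tm} (h : E0 s t) : s.nf = t.nf := by
  induction h <;> simp_all [Tm.nf, Tm.pow]

/-- The interpretation of tags in the algebra of normal forms. -/
def nfOp : ℕ → Tm → Tm → Tm
  | 0, s, _ => s
  | 1, s, _ => .g s
  | 2, s, t => s.pow t
  | 3, s, t => .mul s t
  | _, s, t => .cmul s t

theorem nf_tagOp (k : ℕ) (s t : Tm) : (tagOp k s t).nf = nfOp k s.nf t.nf := by
  match k with
  | 0 | 1 | 2 | 3 | _ + 4 => rfl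

/-! ### A unifiable system is certified -/

theorem Finset.exists_numbering {α : Type*} [DecidableEq α] (r : α → ℕ) (T : Finset α) :
    ∃ f : α → ℕ, (∀ t ∈ T, f t < T.card) ∧ (∀ s ∈ T, ∀ t ∈ T, f s = f t → s = t) ∧
      ∀ s ∈ T, ∀ t ∈ T, r s < r t → f s < f t := by
  induction T using Finset.induction_on_max_value r with
  | empty => exact ⟨fun _ => 0, by simp⟩
  | insert a T ha hmax ih =>
    obtain ⟨f, hlt, hinj, hmono⟩ := ih
    have hf : ∀ t ∈ T, Function.update f a T.card t = f t := fun t ht =>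
      Function.update_of_ne (ne_of_mem_of_not_mem ht ha) _ _
    refine ⟨Function.update f a T.card, ?_, ?_, ?_⟩
    · rw [Finset.card_insert_of_notMem ha]
      intro t ht
      rcases Finset.mem_insert.1 ht with rfl | ht
      · simp
      · rw [hf t ht]
        exact (hlt t ht).trans (Nat.lt_succ_self _)
    · intro s hs t ht h
      rcases Finset.mem_insert.1 hs with rfl | hs' <;>
        rcases Finset.mem_insert.1 ht with rfl | ht'
      · rfl
      · rw [Function.update_self, hf t ht'] at h
        exact absurd h (hlt t ht').ne'
      · rw [Function.update_self, hf s hs'] at h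
        exact absurd h (hlt s hs').ne
      · rw [hf t ht', hf s hs'] at h
        exact hinj s hs' t ht' h
    · intro s hs t ht h
      rcases Finset.mem_insert.1 hs with rfl | hs' <;>
        rcases Finset.mem_insert.1 ht with rfl | ht'
      · exact absurd h (lt_irrefl _)
      · exact absurd h (hmax t ht').not_gt
      · rw [Function.update_self, hf s hs']
        exact hlt s hs'
      · rw [hf t ht', hf s hs']
        exact hmono s hs' t ht' h

/-- The iterated factors of a list of terms, up to a given depth. -/
def iterFactors (l : List Tm) : ℕ → List Tm
  | 0 => l
  | k + 1 => iterFactors l k ++ (iterFactors l k).flatMap Tm.factors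

theorem length_flatMap_le {α β : Type*} {f : α → List β} {c : ℕ} (hf : ∀ a, (f a).length ≤ c)
    (l : List α) : (l.flatMap f).length ≤ c * l.length := by
  induction l with
  | nil => simp
  | cons a l ih =>
    have := hf a
    simp only [List.flatMap_cons, List.length_append, List.length_cons]
    linarith

theorem length_iterFactors_le (l : List Tm) (k : ℕ) :
    (iterFactors l k).length ≤ 3 ^ k * l.length := by
  induction k with
  | zero => simp [iterFactors]
  | succ k ih =>
    have := length_flatMap_le (f := Tm.factors) (c := 2)
      (fun t => by cases t <;> simp [Tm.factors]) (iterFactors l k)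
    rw [iterFactors, List.length_append, pow_succ]
    linarith

theorem mem_iterFactors_of_le {l : List Tm} {t : Tm} {j k : ℕ} (hjk : j ≤ k)
    (h : t ∈ iterFactors l j) : t ∈ iterFactors l k := by
  induction hjk with
  | refl => exact h
  | step _ ih => exact List.mem_append_left _ ih

/-- `P` holds for the values of the variables below `m`, is inherited by those factors whose shapes
are shapes of values, and is confined to `T`, up to arguments of `g`. -/
structure FactorClosed (val : ℕ → Tm) (m : ℕ) (P : Tm → Prop) (T : List Tm) : Prop where
  length_le : T.length ≤ 2 * (3 ^ m * m)
  val_mem : ∀ u < m, P (val u)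
  mem : ∀ t, P t → t ∈ T
  mem_of_g : ∀ t, P (.g t) → t ∈ T
  of_mul : ∀ a b v w, P (.mul a b) → v < m → w < m → a.shape = (val v).shape →
    b.shape = (val w).shape → P a ∧ P b

open Classical in
theorem exists_factorClosed (val : ℕ → Tm) (m : ℕ) : ∃ P T, FactorClosed val m P T := by
  let S : Finset Tm := (Finset.range m).image fun u => (val u).shape
  have hS : ∀ u < m, (val u).shape ∈ S := fun u hu =>
    Finset.mem_image_of_mem _ (Finset.mem_range.2 hu)
  let l := (List.range m).map val
  let rank : Tm → ℕ := fun t => (S.filter fun s => s.size < t.shape.size).card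
  let T := iterFactors l m
  have hT : T.length ≤ 3 ^ m * m := by
    simpa [l] using length_iterFactors_le l m
  let P : Tm → Prop := fun t => t.shape ∈ S ∧ ∃ k, t ∈ iterFactors l k ∧ k + rank t < m
  have hPT : ∀ t, P t → t ∈ T := fun t ⟨_, k, hk, hkm⟩ => mem_iterFactors_of_le (by omega) hk
  have hfactor : ∀ t a, P t → a ∈ t.factors → a.shape.size < t.shape.size → a.shape ∈ S →
      P a := by
    rintro t a ⟨-, k, hk, hkm⟩ ha hlt haS
    refine ⟨haS, k + 1, List.mem_append_right _ (List.mem_flatMap.2 ⟨t, hk, ha⟩), ?_⟩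
    have : rank a < rank t := by
      refine Finset.card_lt_card (Finset.ssubset_iff_of_subset ?_ |>.2 ⟨a.shape, ?_, ?_⟩)
      · exact Finset.monotone_filter_right _ fun s _ hs => hs.trans hlt
      · exact Finset.mem_filter.2 ⟨haS, hlt⟩
      · simp
    omega
  refine ⟨P, T ++ T.flatMap Tm.gArg, ?_, ?_, ?_, ?_, ?_⟩
  · have := length_flatMap_le (f := Tm.gArg) (c := 1)
      (fun t => by cases t <;> simp [Tm.gArg]) T
    rw [List.length_append]
    linarith
  · refine fun u hu => ⟨hS u hu, 0, List.mem_map_of_mem (List.mem_range.2 hu), ?_⟩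
    have h1 : rank (val u) < S.card :=
      Finset.card_lt_card (Finset.filter_ssubset.2 ⟨_, hS u hu, lt_irrefl _⟩)
    have h2 : S.card ≤ m := Finset.card_image_le.trans (Finset.card_range m).le
    omega
  · exact fun t ht => List.mem_append_left _ (hPT t ht)
  · exact fun t ht => List.mem_append_right _
      (List.mem_flatMap.2 ⟨_, hPT _ ht, by simp [Tm.gArg]⟩)
  · intro a b v w h hv hw ha hb
    refine ⟨hfactor _ a h ?_ ?_ (ha ▸ hS v hv), hfactor _ b h ?_ ?_ (hb ▸ hS w hw)⟩ <;>
      simp only [Tm.factors, Tm.shape, Tm.size, List.mem_cons, true_or, or_true] <;> omega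

/-- The quadruple `(k, u, a, b)` of terms is among the equations used in a certificate: `P` selects
the relevant terms, `A` the products to be decomposed, and `B` the exponents. -/
def NodeEq (P A B : Tm → Prop) (k : ℕ) (u a b : Tm) : Prop :=
  (k = 1 ∧ P u ∧ u = .g a ∧ b = a) ∨
  (k = 2 ∧ P u ∧ P a ∧ B b ∧ u = a.pow b) ∨
  (k = 3 ∧ P u ∧ A u ∧ u = .mul a b) ∨
  (k = 4 ∧ (P u ∨ P (.g u)) ∧ (P a ∨ P (.g a)) ∧ B b ∧ u = .cmul a b)

section NodeEq

variable {P A B : Tm → Prop} {k k' : ℕ} {u a b c d : Tm}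

theorem NodeEq.tag (h : NodeEq P A B k u a b) : 1 ≤ k ∧ k ≤ 4 := by
  rcases h with h | h | h | h <;> omega

theorem NodeEq.size_lt (h : NodeEq P A B k u a b) : a.size < u.size ∧ b.size < u.size := by
  rcases h with ⟨-, -, rfl, rfl⟩ | ⟨-, -, -, -, rfl⟩ | ⟨-, -, -, rfl⟩ | ⟨-, -, -, -, rfl⟩
  · simp [Tm.size]
  · exact Tm.size_lt_pow a b
  all_goals simp only [Tm.size]; omega

theorem NodeEq.unique (h : NodeEq P A B k u a b) (h' : NodeEq P A B k u c d) :
    a = c ∧ b = d := by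
  rcases h with ⟨rfl, -, rfl, rfl⟩ | ⟨rfl, -, -, -, rfl⟩ | ⟨rfl, -, -, rfl⟩ | ⟨rfl, -, -, -, rfl⟩
  · simp_all [NodeEq]
  · exact Tm.pow_inj (by simpa using h'.resolve_left (by simp) |>.resolve_right (by simp) |>.2.2.2.2)
  · simp_all [NodeEq]
  · simp_all [NodeEq]

theorem NodeEq.decompose (hP : ∀ a b, P (.mul a b) → A (.mul a b) → P a ∧ P b)
    (hA : ∀ s t : Tm, s.shape = t.shape → A s → A t)
    (h : NodeEq P A B k u a b) (h' : NodeEq P A B k' u c d) (hk : k < k') :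
    (k = 1 ∧ k' = 2 ∧ ∃ z, NodeEq P A B 1 c z z ∧ NodeEq P A B 4 a z d) ∨
    (k = 2 ∧ k' = 3 ∧ ∃ z w, NodeEq P A B 3 a z w ∧ NodeEq P A B 2 c z b ∧
      NodeEq P A B 2 d w b) := by
  rcases h with ⟨rfl, hu, rfl, rfl⟩ | ⟨rfl, hu, ha, hb, rfl⟩ | ⟨rfl, hu, hu', rfl⟩ | ⟨rfl, _⟩
  · rcases h' with ⟨rfl, _⟩ | ⟨rfl, -, hc, hd, e⟩ | ⟨rfl, -, -, e⟩ | ⟨rfl, -, -, -, e⟩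
    · omega
    · obtain ⟨z, rfl, rfl⟩ := Tm.pow_eq_g e.symm
      exact .inl ⟨rfl, rfl, z, by simp [NodeEq, hc], by simp [NodeEq, hc, hu, hd]⟩
    · cases e
    · cases e
  · rcases h' with ⟨rfl, _⟩ | ⟨rfl, _⟩ | ⟨rfl, -, hu', e⟩ | ⟨rfl, -, -, -, e⟩
    · omega
    · omega
    · obtain ⟨z, w, rfl, rfl, rfl⟩ := Tm.pow_eq_mul e
      have hz := hA _ _ (Tm.shape_pow _ _) hu'
      have h1 := hP _ _ ha hz
      rw [e] at hu hu'
      have h2 := hP _ _ hu hu'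
      exact .inr ⟨rfl, rfl, z, w, by simp [NodeEq, ha, hz], by simp [NodeEq, h1, h2, hb],
        by simp [NodeEq, h1, h2, hb]⟩
    · exact absurd e (Tm.pow_ne_cmul _ _ _ _)
  · rcases h' with ⟨rfl, _⟩ | ⟨rfl, _⟩ | ⟨rfl, _⟩ | ⟨rfl, -, -, -, e⟩
    · omega
    · omega
    · omega
    · cases e
  · rcases h' with ⟨rfl, _⟩ | ⟨rfl, _⟩ | ⟨rfl, _⟩ | ⟨rfl, _⟩ <;> omega

end NodeEq

theorem exists_certificate {K : List Quad} {val : ℕ → Tm}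
    (htag : ∀ e ∈ K, e.1 ≤ 4 ∧ (e.1 ≤ 1 → e.2.2.2 = e.2.2.1))
    (hval : ∀ e ∈ K, val e.2.1 = nfOp e.1 (val e.2.2.1) (val e.2.2.2)) :
    ∃ Q ∈ allSublists (quads (certBound (entryBound K))), Certifies Q K := by
  classical
  set m := entryBound K with hm
  obtain ⟨P, T, hT⟩ := exists_factorClosed val m
  let A : Tm → Prop := fun t => ∃ e ∈ K, e.1 = 3 ∧ (val e.2.1).shape = t.shape
  let B : Tm → Prop := fun t => ∃ u < m, val u = t
  have hA : ∀ s t : Tm, s.shape = t.shape → A s → A t := fun s t h ⟨e, he, h3, hs⟩ =>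
    ⟨e, he, h3, hs.trans h⟩
  have hP : ∀ a b, P (.mul a b) → A (.mul a b) → P a ∧ P b := by
    rintro a b hab ⟨e, he, h3, hs⟩
    have hlt := lt_entryBound he
    rw [hval e he, h3] at hs
    simp only [nfOp, Tm.shape, Tm.mul.injEq] at hs
    exact hT.of_mul a b _ _ hab hlt.2.1 hlt.2.2 hs.1.symm hs.2.symm
  have hB : ∀ t, B t → P t := by
    rintro _ ⟨u, hu, rfl⟩
    exact hT.val_mem u hu
  obtain ⟨f, hlt, hinj, hmono⟩ := T.toFinset.exists_numbering Tm.size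
  simp only [List.mem_toFinset] at hlt hinj hmono
  have hcard : T.toFinset.card ≤ 2 * (3 ^ m * m) := (List.toFinset_card_le T).trans hT.length_le
  have hmemT : ∀ {k u a b}, NodeEq P A B k u a b → u ∈ T ∧ a ∈ T ∧ b ∈ T := by
    have hT' : ∀ t, P t ∨ P (.g t) → t ∈ T := fun t h => h.elim (hT.mem t) (hT.mem_of_g t)
    rintro k u a b (⟨-, hu, rfl, rfl⟩ | ⟨-, hu, ha, hb, -⟩ | ⟨-, hu, hu', rfl⟩ | ⟨-, hu, ha, hb, -⟩)
    · exact ⟨hT.mem _ hu, hT.mem_of_g _ hu, hT.mem_of_g _ hu⟩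
    · exact ⟨hT.mem _ hu, hT.mem _ ha, hT.mem _ (hB _ hb)⟩
    · have := hP _ _ hu hu'
      exact ⟨hT.mem _ hu, hT.mem _ this.1, hT.mem _ this.2⟩
    · exact ⟨hT' _ hu, hT' _ ha, hT.mem _ (hB _ hb)⟩
  let R : Quad → Prop := fun x =>
    (x.1 = 0 ∧ x.2.1 < m ∧ x.2.2.1 = f (val x.2.1) ∧ x.2.2.2 = x.2.2.1) ∨
      ∃ u a b, x.2 = (f u, f a, f b) ∧ NodeEq P A B x.1 u a b
  let Q := (quads (certBound m)).filter fun x => decide (R x)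
  have hQ : ∀ x, x ∈ Q ↔ R x := by
    rintro ⟨k, i, j, l⟩
    simp only [Q, List.mem_filter, decide_eq_true_eq, and_iff_right_iff_imp]
    rintro (⟨h1, h2, h3, h4⟩ | ⟨u, a, b, h, hn⟩)
    · simp only at h1 h2 h3 h4
      have := hlt _ (hT.mem _ (hT.val_mem i h2))
      apply mem_quads <;> unfold certBound <;> omega
    · simp only [Prod.mk.injEq] at h
      obtain ⟨rfl, rfl, rfl⟩ := h
      have ht := hn.tag
      obtain ⟨h1, h2, h3⟩ := hmemT hn
      have h1 := hlt _ h1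
      have h2 := hlt _ h2
      have h3 := hlt _ h3
      simp only at ht
      apply mem_quads <;> unfold certBound <;> omega
  have hQnode : ∀ {k u a b}, NodeEq P A B k u a b → (k, f u, f a, f b) ∈ Q := fun h =>
    (hQ _).2 (.inr ⟨_, _, _, rfl, h⟩)
  have hQval : ∀ {u}, u < m → (0, u, f (val u), f (val u)) ∈ Q := fun h =>
    (hQ _).2 (.inl ⟨rfl, h, rfl, rfl⟩)
  refine ⟨Q, filter_mem_allSublists _ _, ?_, ?_, ?_⟩
  · intro e he
    obtain ⟨h1, h2, h3⟩ := lt_entryBound he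
    refine ⟨_, hQval h1, _, hQval h2, _, hQval h3, ⟨rfl, rfl⟩, ⟨rfl, rfl⟩, ⟨rfl, rfl⟩, ?_⟩
    have hv := hval e he
    obtain ⟨h4, hle⟩ := htag e he
    by_cases h0 : e.1 = 0
    · rw [h0] at hv
      exact .inl ⟨h0, congrArg f hv⟩
    · refine .inr ⟨h0, hQnode ?_⟩
      have hp1 := hT.val_mem _ h1
      have hp2 := hT.val_mem _ h2
      have hb : B (val e.2.2.2) := ⟨_, h3, rfl⟩
      have hcases : e.1 = 1 ∨ e.1 = 2 ∨ e.1 = 3 ∨ e.1 = 4 := by omega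
      rcases hcases with h | h | h | h <;> rw [h] at hv
      · exact .inl ⟨h, hp1, hv, by rw [hle h.le]⟩
      · exact .inr (.inl ⟨h, hp1, hp2, hb, hv⟩)
      · exact .inr (.inr (.inl ⟨h, hp1, ⟨e, he, h, rfl⟩, hv⟩))
      · exact .inr (.inr (.inr ⟨h, .inl hp1, .inl hp2, hb, hv⟩))
  · intro x hx
    rcases (hQ x).1 hx with hx | ⟨u, a, b, hxe, hxn⟩
    · exact ⟨.inl hx.1, fun _ _ => .inr (.inl hx.1)⟩
    obtain ⟨k, x⟩ := x
    obtain rfl : x = _ := hxe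
    have hxT := hmemT hxn
    have hs := hxn.size_lt
    refine ⟨.inr ⟨hmono _ hxT.2.1 _ hxT.1 hs.1, hmono _ hxT.2.2 _ hxT.1 hs.2⟩, fun y hy => ?_⟩
    simp only at hxn ⊢
    have hxtag := hxn.tag
    rcases (hQ y).1 hy with hy | ⟨u', c, d, hye, hyn⟩
    · refine .inr (.inr (.inl ⟨by omega, .inl (by omega)⟩))
    obtain ⟨k', y⟩ := y
    obtain rfl : y = _ := hye
    simp only at hyn ⊢
    by_cases hu : f u = f u'
    swap
    · exact .inl hu
    obtain rfl := hinj _ hxT.1 _ (hmemT hyn).1 hu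
    refine .inr (.inr ?_)
    rcases lt_trichotomy k k' with hk | rfl | hk
    · right
      rcases hxn.decompose hP hA hyn hk with ⟨h1, h2, z, hz, hz'⟩ | ⟨h1, h2, z, w, hz, hz', hw⟩
      · exact .inl ⟨h1, h2, _, hQnode hz, rfl, rfl, hQnode hz'⟩
      · exact .inr ⟨h1, h2, _, hQnode hz, rfl, rfl, hQnode hz', hQnode hw⟩
    · obtain ⟨rfl, rfl⟩ := hxn.unique hyn
      exact .inl ⟨lt_irrefl _, .inr rfl⟩
    · exact .inl ⟨by omega, .inl (by omega)⟩
  · intro x hx y hy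
    rcases (hQ x).1 hx with hx | ⟨u, a, b, hxe, hxn⟩
    · rcases (hQ y).1 hy with hy | ⟨u', c, d, hye, hyn⟩
      · by_cases h : x.2.1 = y.2.1
        · rw [hx.2.2.1, hy.2.2.1, h]
          simp
        · exact .inr (.inr (.inl h))
      · have := hyn.tag
        exact .inr (.inl (by omega))
    · have := hxn.tag
      exact .inl (by omega)

/-- Unification modulo E₀ is decidable: under the effective encoding of
equation systems (finite sets of equations, presented as lists) as natural
numbers, the set of E₀-unifiable equation systems is a computable predicate. -/
theorem E0_unification_decidable :
    ComputablePred (fun L : List Eqn =>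
      ∃ σ : ℕ → Tm, ∀ e ∈ L, E0 (σ e.1) (Flat.toTm σ e.2)) := by
  refine computablePred_exists_certificate.of_eq fun L => ⟨?_, ?_⟩
  · rintro ⟨Q, -, hQ⟩
    obtain ⟨σ, hσ⟩ := hQ.exists_holds
    refine ⟨σ, fun e he => ?_⟩
    have := hσ _ (List.mem_map_of_mem he)
    rwa [Quad.Holds, tagOp_toQuad, toQuad_snd_fst] at this
  · rintro ⟨σ, hσ⟩
    refine exists_certificate (val := fun u => (σ u).nf) ?_ ?_
    · intro q hq
      obtain ⟨e, -, rfl⟩ := List.mem_map.1 hq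
      exact ⟨toQuad_tag_le _ _, toQuad_of_tag_le_one _ _⟩
    · intro q hq
      obtain ⟨e, he, rfl⟩ := List.mem_map.1 hq
      rw [← nf_tagOp, tagOp_toQuad, toQuad_snd_fst]
      exact (hσ e he).nf_eq
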